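/- Let n ≥ 1, and let Q ∈ Pauli(n) be a Pauli operator satisfying Q² = I such that Q anticommutes with Z ⊗ I ⊗ ⋯ ⊗ I (the operator with Z on the first qubit and identity elsewhere). Then there exists a Clifford operator M ∈ Clifford(n) such that M Q M⁻¹ = I ⊗ ⋯ ⊗ I ⊗ X and M (Z ⊗ I ⊗ ⋯ ⊗ I) M⁻¹ = I ⊗ ⋯ ⊗ I ⊗ Z (with X, respectively Z, on the last qubit and identity elsewhere). -/

import Mathlib

open scoped Matrix Kronecker

noncomputable section

def PX : Matrix (Fin 2) (Fin 2) ℂ := !![0, 1; 1, 0]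
def PY : Matrix (Fin 2) (Fin 2) ℂ := !![0, -Complex.I; Complex.I, 0]
def PZ : Matrix (Fin 2) (Fin 2) ℂ := !![1, 0; 0, -1]
def gH : Matrix (Fin 2) (Fin 2) ℂ := (Real.sqrt 2 : ℂ)⁻¹ • !![1, 1; 1, -1]
def gS : Matrix (Fin 2) (Fin 2) ℂ := !![1, 0; 0, Complex.I]
def gCZ : Matrix (Fin 4) (Fin 4) ℂ :=
  !![1,0,0,0; 0,1,0,0; 0,0,1,0; 0,0,0,-1]
def ω : ℂ := Complex.exp (Complex.I * Real.pi / 4)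

/-- Kronecker product of square matrices, with index types flattened to `Fin (m * k)`. -/
def kron' {m k : ℕ} (A : Matrix (Fin m) (Fin m) ℂ) (B : Matrix (Fin k) (Fin k) ℂ) :
    Matrix (Fin (m * k)) (Fin (m * k)) ℂ :=
  Matrix.reindex finProdFinEquiv finProdFinEquiv (A ⊗ₖ B)

/-- `n`-fold tensor product `P 0 ⊗ P 1 ⊗ ⋯ ⊗ P (n-1)` of 2×2 matrices. -/
def tensorPow : (n : ℕ) → (Fin n → Matrix (Fin 2) (Fin 2) ℂ) →
    Matrix (Fin (2 ^ n)) (Fin (2 ^ n)) ℂ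
  | 0, _ => 1
  | n + 1, P =>
      Matrix.reindex (finCongr (pow_succ' 2 n).symm) (finCongr (pow_succ' 2 n).symm)
        (kron' (P 0) (tensorPow n fun i => P i.succ))

/-- The set of n-qubit Pauli operators: λ • P₁ ⊗ ⋯ ⊗ Pₙ with λ ∈ {1,-1,i,-i},
    Pⱼ ∈ {I, X, Y, Z}. -/
def PauliSet (n : ℕ) : Set (Matrix (Fin (2 ^ n)) (Fin (2 ^ n)) ℂ) :=
  {M | ∃ (lam : ℂ) (P : Fin n → Matrix (Fin 2) (Fin 2) ℂ),
    lam ∈ ({1, -1, Complex.I, -Complex.I} : Set ℂ) ∧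
    (∀ i, P i ∈ ({1, PX, PY, PZ} : Set (Matrix (Fin 2) (Fin 2) ℂ))) ∧
    M = lam • tensorPow n P}

/-- `I_{2^a} ⊗ G ⊗ I_{2^b}`, where `G` acts on `c` qubits and `a + c + b = n`. -/
def embed (a c b n : ℕ) (h : a + c + b = n)
    (G : Matrix (Fin (2 ^ c)) (Fin (2 ^ c)) ℂ) :
    Matrix (Fin (2 ^ n)) (Fin (2 ^ n)) ℂ :=
  Matrix.reindex (finCongr (by subst h; rw [pow_add, pow_add, mul_assoc]))
    (finCongr (by subst h; rw [pow_add, pow_add, mul_assoc]))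
    (kron' (1 : Matrix (Fin (2 ^ a)) (Fin (2 ^ a)) ℂ)
      (kron' G (1 : Matrix (Fin (2 ^ b)) (Fin (2 ^ b)) ℂ)))

/-- Generators of the Clifford group: ω•I, and H, S, CZ applied to (adjacent) qubits. -/
def CliffordGenSet (n : ℕ) : Set (Matrix (Fin (2 ^ n)) (Fin (2 ^ n)) ℂ) :=
  {ω • 1} ∪
  {M | ∃ a b, ∃ h : a + 1 + b = n, M = embed a 1 b n h gH ∨ M = embed a 1 b n h gS} ∪
  {M | ∃ a b, ∃ h : a + 2 + b = n, M = embed a 2 b n h gCZ}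

/-- The Clifford group on n qubits, as a subgroup of `GL (2^n) ℂ`. -/
def CliffordGroup (n : ℕ) : Subgroup (GL (Fin (2 ^ n)) ℂ) :=
  Subgroup.closure
    {u : GL (Fin (2 ^ n)) ℂ | (u : Matrix (Fin (2 ^ n)) (Fin (2 ^ n)) ℂ) ∈ CliffordGenSet n}

/-- The Pauli group on n qubits, as a subgroup of `GL (2^n) ℂ`.
    (Its underlying set of matrices is exactly `PauliSet n`.) -/
def PauliGroup (n : ℕ) : Subgroup (GL (Fin (2 ^ n)) ℂ) :=
  Subgroup.closure
    {u : GL (Fin (2 ^ n)) ℂ | (u : Matrix (Fin (2 ^ n)) (Fin (2 ^ n)) ℂ) ∈ PauliSet n}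

/-- Z on the first qubit, identity elsewhere. -/
def ZFirst (n : ℕ) : Matrix (Fin (2 ^ n)) (Fin (2 ^ n)) ℂ :=
  tensorPow n fun i => if i.val = 0 then PZ else 1

/-- Z on the last qubit, identity elsewhere. -/
def ZLast (n : ℕ) : Matrix (Fin (2 ^ n)) (Fin (2 ^ n)) ℂ :=
  tensorPow n fun i => if i.val = n - 1 then PZ else 1

/-- X on the last qubit, identity elsewhere. -/
def XLast (n : ℕ) : Matrix (Fin (2 ^ n)) (Fin (2 ^ n)) ℂ :=
  tensorPow n fun i => if i.val = n - 1 then PX else 1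

/-- Kronecker product of square matrices whose index type is `Fin n` for a given `n = m * k`. -/
def kronCast {m k n : ℕ} (h : m * k = n) (A : Matrix (Fin m) (Fin m) ℂ)
    (B : Matrix (Fin k) (Fin k) ℂ) : Matrix (Fin n) (Fin n) ℂ :=
  Matrix.reindex (finCongr h) (finCongr h) (kron' A B)

lemma kronCast_mul {m k n : ℕ} (h : m * k = n) (A C : Matrix (Fin m) (Fin m) ℂ)
    (B D : Matrix (Fin k) (Fin k) ℂ) :
    kronCast h A B * kronCast h C D = kronCast h (A * C) (B * D) := by
  subst h
  simp [kronCast, kron', Matrix.mul_kronecker_mul, Matrix.submatrix_mul_equiv]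

lemma kronCast_one {m k n : ℕ} (h : m * k = n) :
    kronCast h (1 : Matrix (Fin m) (Fin m) ℂ) (1 : Matrix (Fin k) (Fin k) ℂ) = 1 := by
  subst h
  simp [kronCast, kron']

lemma kronCast_smul_left {m k n : ℕ} (h : m * k = n) (c : ℂ) (A : Matrix (Fin m) (Fin m) ℂ)
    (B : Matrix (Fin k) (Fin k) ℂ) : kronCast h (c • A) B = c • kronCast h A B := by
  subst h
  simp [kronCast, kron', Matrix.smul_kronecker, Matrix.submatrix_smul]

lemma kronCast_smul_right {m k n : ℕ} (h : m * k = n) (c : ℂ) (A : Matrix (Fin m) (Fin m) ℂ)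
    (B : Matrix (Fin k) (Fin k) ℂ) : kronCast h A (c • B) = c • kronCast h A B := by
  subst h
  simp [kronCast, kron', Matrix.kronecker_smul, Matrix.submatrix_smul]

lemma kronCast_apply {m k n : ℕ} (h : m * k = n) (A : Matrix (Fin m) (Fin m) ℂ)
    (B : Matrix (Fin k) (Fin k) ℂ) (i j : Fin n) :
    kronCast h A B i j = A (i.cast h.symm).divNat (j.cast h.symm).divNat *
      B (i.cast h.symm).modNat (j.cast h.symm).modNat := rfl

lemma kronCast_assoc {m k l mk kl n : ℕ} (h₁ : m * k = mk) (h₂ : mk * l = n) (h₃ : k * l = kl)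
    (h₄ : m * kl = n) (A : Matrix (Fin m) (Fin m) ℂ) (B : Matrix (Fin k) (Fin k) ℂ)
    (C : Matrix (Fin l) (Fin l) ℂ) :
    kronCast h₂ (kronCast h₁ A B) C = kronCast h₄ A (kronCast h₃ B C) := by
  subst h₁ h₃ h₂
  ext i j
  have e₁ : ∀ i : Fin (m * k * l), (((i.cast rfl).divNat.cast rfl : Fin (m * k)).divNat : Fin m) =
      (i.cast h₄.symm : Fin (m * (k * l))).divNat := fun i => by
    ext; simp [Fin.divNat, Nat.div_div_eq_div_mul, mul_comm]
  have e₂ : ∀ i : Fin (m * k * l), (((i.cast rfl).divNat.cast rfl : Fin (m * k)).modNat : Fin k) =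
      ((i.cast h₄.symm : Fin (m * (k * l))).modNat.cast rfl : Fin (k * l)).divNat := fun i => by
    ext; simp [Fin.divNat, Fin.modNat, Nat.mod_mul_left_div_self]
  have e₃ : ∀ i : Fin (m * k * l), ((i.cast rfl).modNat : Fin l) =
      ((i.cast h₄.symm : Fin (m * (k * l))).modNat.cast rfl : Fin (k * l)).modNat := fun i => by
    ext; simp [Fin.modNat]
  simp only [kronCast_apply]
  rw [e₁, e₁, e₂, e₂, e₃, e₃, mul_assoc]

lemma kronCast_one_left {k n : ℕ} (h : 1 * k = n) (h' : k = n) (B : Matrix (Fin k) (Fin k) ℂ) :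
    kronCast h 1 B = Matrix.reindex (finCongr h') (finCongr h') B := by
  subst h'
  ext i j
  have e : ∀ i : Fin k, ((i.cast h.symm : Fin (1 * k)).modNat : Fin k) = i := fun i => by
    ext; simp [Fin.modNat, Nat.mod_eq_of_lt i.2]
  rw [kronCast_apply, e, e, Subsingleton.elim (Fin.divNat _) (0 : Fin 1),
    Subsingleton.elim (Fin.divNat _) (0 : Fin 1)]
  simp

/-- `A ⊗ B` with `A` acting on the first of `n + 1` qubits. -/
def kronFirst (n : ℕ) (A : Matrix (Fin 2) (Fin 2) ℂ) (B : Matrix (Fin (2 ^ n)) (Fin (2 ^ n)) ℂ) :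
    Matrix (Fin (2 ^ (n + 1))) (Fin (2 ^ (n + 1))) ℂ :=
  kronCast (pow_succ' 2 n).symm A B

lemma tensorPow_succ (n : ℕ) (P : Fin (n + 1) → Matrix (Fin 2) (Fin 2) ℂ) :
    tensorPow (n + 1) P = kronFirst n (P 0) (tensorPow n fun i => P i.succ) := rfl

lemma kronFirst_mul (n : ℕ) (A C : Matrix (Fin 2) (Fin 2) ℂ)
    (B D : Matrix (Fin (2 ^ n)) (Fin (2 ^ n)) ℂ) :
    kronFirst n A B * kronFirst n C D = kronFirst n (A * C) (B * D) :=
  kronCast_mul _ _ _ _ _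

lemma kronFirst_one (n : ℕ) : kronFirst n 1 1 = 1 := kronCast_one _

lemma kronFirst_smul_left (n : ℕ) (c : ℂ) (A : Matrix (Fin 2) (Fin 2) ℂ)
    (B : Matrix (Fin (2 ^ n)) (Fin (2 ^ n)) ℂ) :
    kronFirst n (c • A) B = c • kronFirst n A B :=
  kronCast_smul_left _ _ _ _

lemma embed_eq_kronCast {a c b n : ℕ} (h : a + c + b = n)
    (h' : 2 ^ a * (2 ^ c * 2 ^ b) = 2 ^ n) (G : Matrix (Fin (2 ^ c)) (Fin (2 ^ c)) ℂ) :
    embed a c b n h G = kronCast h' 1 (kronCast rfl G 1) := rfl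

lemma two_pow_split {a c b n : ℕ} (h : a + c + b = n) : 2 ^ a * (2 ^ c * 2 ^ b) = 2 ^ n := by
  rw [← h, pow_add, pow_add, mul_assoc]

lemma embed_mul {a c b n : ℕ} (h : a + c + b = n) (G K : Matrix (Fin (2 ^ c)) (Fin (2 ^ c)) ℂ) :
    embed a c b n h G * embed a c b n h K = embed a c b n h (G * K) := by
  simp only [embed_eq_kronCast h (two_pow_split h), kronCast_mul, mul_one]

lemma embed_one {a c b n : ℕ} (h : a + c + b = n) : embed a c b n h 1 = 1 := by
  simp only [embed_eq_kronCast h (two_pow_split h), kronCast_one]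

lemma kronFirst_one_embed {a c b n : ℕ} (h : a + c + b = n) (h' : a + 1 + c + b = n + 1)
    (G : Matrix (Fin (2 ^ c)) (Fin (2 ^ c)) ℂ) :
    kronFirst n 1 (embed a c b n h G) = embed (a + 1) c b (n + 1) h' G := by
  rw [embed_eq_kronCast h (two_pow_split h), embed_eq_kronCast h' (two_pow_split h'),
    ← kronCast_one (pow_succ' 2 a).symm, kronCast_assoc]
  rfl

lemma embed_zero {c b n : ℕ} (h : 0 + c + b = n) (h' : 2 ^ c * 2 ^ b = 2 ^ n)
    (G : Matrix (Fin (2 ^ c)) (Fin (2 ^ c)) ℂ) :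
    embed 0 c b n h G = kronCast h' G 1 :=
  kronCast_one_left (by rw [one_mul, h']) h' _

lemma embed_first_qubit {n : ℕ} (h : 0 + 1 + n = n + 1) (G : Matrix (Fin 2) (Fin 2) ℂ) :
    embed 0 1 n (n + 1) h G = kronFirst n G 1 :=
  embed_zero h (pow_succ' 2 n).symm G

/-- `M` is the matrix of a Clifford operator. -/
def IsClifford (n : ℕ) (M : Matrix (Fin (2 ^ n)) (Fin (2 ^ n)) ℂ) : Prop :=
  ∃ u ∈ CliffordGroup n, (u : Matrix (Fin (2 ^ n)) (Fin (2 ^ n)) ℂ) = M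

lemma isClifford_of_mem_genSet {n : ℕ} {M N : Matrix (Fin (2 ^ n)) (Fin (2 ^ n)) ℂ}
    (hM : M ∈ CliffordGenSet n) (hMN : M * N = 1) : IsClifford n M :=
  ⟨⟨M, N, hMN, mul_eq_one_comm.mp hMN⟩, Subgroup.subset_closure hM, rfl⟩

lemma isClifford_one (n : ℕ) : IsClifford n 1 := ⟨1, one_mem _, rfl⟩

lemma IsClifford.mul {n : ℕ} {M N : Matrix (Fin (2 ^ n)) (Fin (2 ^ n)) ℂ}
    (hM : IsClifford n M) (hN : IsClifford n N) : IsClifford n (M * N) := by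
  obtain ⟨u, hu, rfl⟩ := hM
  obtain ⟨v, hv, rfl⟩ := hN
  exact ⟨u * v, mul_mem hu hv, rfl⟩

/-- The homomorphism `U ↦ I ⊗ U`. -/
def kronFirstHom (n : ℕ) : GL (Fin (2 ^ n)) ℂ →* GL (Fin (2 ^ (n + 1))) ℂ :=
  Units.map
    { toFun := kronFirst n 1
      map_one' := kronFirst_one n
      map_mul' := fun B D => by rw [kronFirst_mul, one_mul] }

lemma cliffordGroup_le_comap (n : ℕ) :
    CliffordGroup n ≤ (CliffordGroup (n + 1)).comap (kronFirstHom n) := by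
  refine (Subgroup.closure_le _).mpr fun u hu => Subgroup.subset_closure ?_
  change kronFirst n 1 (u : Matrix (Fin (2 ^ n)) (Fin (2 ^ n)) ℂ) ∈ CliffordGenSet (n + 1)
  rcases hu with (hu | ⟨a, b, h, hu⟩) | ⟨a, b, h, hu⟩
  · refine Or.inl (Or.inl ?_)
    rw [Set.mem_singleton_iff.mp hu, Set.mem_singleton_iff, kronFirst, kronCast_smul_right,
      kronCast_one]
  · refine Or.inl (Or.inr ⟨a + 1, b, by omega, ?_⟩)
    rcases hu with hu | hu
    · exact Or.inl (by rw [hu, kronFirst_one_embed])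
    · exact Or.inr (by rw [hu, kronFirst_one_embed])
  · exact Or.inr ⟨a + 1, b, by omega, by rw [hu, kronFirst_one_embed]⟩

lemma IsClifford.kronFirst {n : ℕ} {M : Matrix (Fin (2 ^ n)) (Fin (2 ^ n)) ℂ}
    (hM : IsClifford n M) : IsClifford (n + 1) (kronFirst n 1 M) := by
  obtain ⟨u, hu, rfl⟩ := hM
  exact ⟨kronFirstHom n u, cliffordGroup_le_comap n hu, rfl⟩

lemma gH_mul_gH : gH * gH = 1 := by
  have h : ((Real.sqrt 2 : ℝ) : ℂ) * (Real.sqrt 2 : ℝ) = 2 := by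
    rw [← Complex.ofReal_mul, Real.mul_self_sqrt (by norm_num)]; norm_num
  rw [gH, Matrix.smul_mul, Matrix.mul_smul, smul_smul, ← mul_inv, h]
  ext i j
  fin_cases i <;> fin_cases j <;> norm_num

lemma gS_mul_inv : gS * !![1, 0; 0, -Complex.I] = 1 := by
  ext i j
  fin_cases i <;> fin_cases j <;> simp [gS]

lemma gCZ_mul_gCZ : gCZ * gCZ = 1 := by
  ext i j
  fin_cases i <;> fin_cases j <;> simp [gCZ, Matrix.mul_apply, Fin.sum_univ_four]

lemma isClifford_gH (n : ℕ) : IsClifford (n + 1) (kronFirst n gH 1) := by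
  rw [← embed_first_qubit (by omega)]
  exact isClifford_of_mem_genSet (Or.inl (Or.inr ⟨0, n, by omega, Or.inl rfl⟩))
    ((embed_mul (c := 1) _ gH gH).trans ((congrArg _ gH_mul_gH).trans (embed_one _)))

lemma isClifford_gS (n : ℕ) : IsClifford (n + 1) (kronFirst n gS 1) := by
  rw [← embed_first_qubit (by omega)]
  exact isClifford_of_mem_genSet (Or.inl (Or.inr ⟨0, n, by omega, Or.inr rfl⟩))
    ((embed_mul (c := 1) _ gS _).trans ((congrArg _ gS_mul_inv).trans (embed_one _)))

/-- `CZ` on the first two of `n + 2` qubits. -/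
def czFirst (n : ℕ) : Matrix (Fin (2 ^ (n + 2))) (Fin (2 ^ (n + 2))) ℂ :=
  embed 0 2 n (n + 2) (by omega) gCZ

lemma isClifford_czFirst (n : ℕ) : IsClifford (n + 2) (czFirst n) :=
  isClifford_of_mem_genSet (Or.inr ⟨0, n, by omega, rfl⟩)
    ((embed_mul (c := 2) _ gCZ gCZ).trans ((congrArg _ gCZ_mul_gCZ).trans (embed_one _)))

/-- Kronecker product of two `2 × 2` matrices. -/
def kronTwo (A B : Matrix (Fin 2) (Fin 2) ℂ) : Matrix (Fin 4) (Fin 4) ℂ := kron' A B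

lemma kronFirst_kronFirst {n : ℕ} (h : 4 * 2 ^ n = 2 ^ (n + 2)) (A B : Matrix (Fin 2) (Fin 2) ℂ)
    (R : Matrix (Fin (2 ^ n)) (Fin (2 ^ n)) ℂ) :
    kronFirst (n + 1) A (kronFirst n B R) = kronCast h (kronTwo A B) R :=
  (kronCast_assoc (m := 2) (k := 2) (mk := 4) rfl h (pow_succ' 2 n).symm (pow_succ' 2 (n + 1)).symm
    A B R).symm

lemma czFirst_mul {n : ℕ} {A B C D : Matrix (Fin 2) (Fin 2) ℂ}
    (h : gCZ * kronTwo A B = kronTwo C D * gCZ)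
    (R : Matrix (Fin (2 ^ n)) (Fin (2 ^ n)) ℂ) :
    czFirst n * kronFirst (n + 1) A (kronFirst n B R) =
      kronFirst (n + 1) C (kronFirst n D R) * czFirst n := by
  have e : 4 * 2 ^ n = 2 ^ (n + 2) := by ring
  have hcz : czFirst n = kronCast e gCZ 1 := embed_zero (c := 2) _ e gCZ
  rw [hcz, kronFirst_kronFirst e, kronFirst_kronFirst e, kronCast_mul, kronCast_mul, h, one_mul,
    mul_one]

lemma kronTwo_eq (A B : Matrix (Fin 2) (Fin 2) ℂ) :
    kronTwo A B =
      !![A 0 0 * B 0 0, A 0 0 * B 0 1, A 0 1 * B 0 0, A 0 1 * B 0 1;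
         A 0 0 * B 1 0, A 0 0 * B 1 1, A 0 1 * B 1 0, A 0 1 * B 1 1;
         A 1 0 * B 0 0, A 1 0 * B 0 1, A 1 1 * B 0 0, A 1 1 * B 0 1;
         A 1 0 * B 1 0, A 1 0 * B 1 1, A 1 1 * B 1 0, A 1 1 * B 1 1] := by
  ext i j
  fin_cases i <;> fin_cases j <;> rfl

lemma gCZ_mul_X_one : gCZ * kronTwo PX 1 =
    kronTwo PX PZ * gCZ := by
  rw [kronTwo_eq, kronTwo_eq]
  ext i j
  fin_cases i <;> fin_cases j <;>
    simp [gCZ, PX, PZ, Matrix.mul_apply, Fin.sum_univ_four]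

lemma gCZ_mul_X_Z : gCZ * kronTwo PX PZ =
    kronTwo PX 1 * gCZ := by
  rw [kronTwo_eq, kronTwo_eq]
  ext i j
  fin_cases i <;> fin_cases j <;>
    simp [gCZ, PX, PZ, Matrix.mul_apply, Fin.sum_univ_four]

lemma gCZ_mul_Z_X : gCZ * kronTwo PZ PX =
    kronTwo 1 PX * gCZ := by
  rw [kronTwo_eq, kronTwo_eq]
  ext i j
  fin_cases i <;> fin_cases j <;>
    simp [gCZ, PX, PZ, Matrix.mul_apply, Fin.sum_univ_four]

lemma gCZ_mul_Z_one : gCZ * kronTwo PZ 1 =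
    kronTwo PZ 1 * gCZ := by
  rw [kronTwo_eq]
  ext i j
  fin_cases i <;> fin_cases j <;>
    simp [gCZ, PZ, Matrix.mul_apply, Fin.sum_univ_four]

lemma gCZ_mul_one_Z : gCZ * kronTwo 1 PZ =
    kronTwo 1 PZ * gCZ := by
  rw [kronTwo_eq]
  ext i j
  fin_cases i <;> fin_cases j <;>
    simp [gCZ, PZ, Matrix.mul_apply, Fin.sum_univ_four]

lemma gH_mul_PX : gH * PX = PZ * gH := by
  ext i j
  fin_cases i <;> fin_cases j <;> simp [gH, PX, PZ, Matrix.mul_apply]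

lemma gH_mul_PZ : gH * PZ = PX * gH := by
  ext i j
  fin_cases i <;> fin_cases j <;> simp [gH, PX, PZ, Matrix.mul_apply]

lemma gS_mul_PX : gS * PX = PY * gS := by
  ext i j
  fin_cases i <;> fin_cases j <;> simp [gS, PX, PY, Matrix.mul_apply]

lemma gS_mul_PY : gS * PY = ((-1 : ℂ) • PX) * gS := by
  ext i j
  fin_cases i <;> fin_cases j <;> simp [gS, PX, PY, Matrix.mul_apply]

lemma gS_mul_PZ : gS * PZ = PZ * gS := by
  ext i j
  fin_cases i <;> fin_cases j <;> simp [gS, PZ, Matrix.mul_apply]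

/-- Some Clifford operator conjugates `Q` to `Q'` and `Z` to `Z'`. -/
def CliffordConj (n : ℕ) (Q Z Q' Z' : Matrix (Fin (2 ^ n)) (Fin (2 ^ n)) ℂ) : Prop :=
  ∃ M, IsClifford n M ∧ M * Q = Q' * M ∧ M * Z = Z' * M

namespace CliffordConj

variable {n : ℕ}

lemma refl (Q Z : Matrix (Fin (2 ^ n)) (Fin (2 ^ n)) ℂ) : CliffordConj n Q Z Q Z :=
  ⟨1, isClifford_one n, by simp, by simp⟩

lemma trans {Q Z Q' Z' Q'' Z'' : Matrix (Fin (2 ^ n)) (Fin (2 ^ n)) ℂ}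
    (h : CliffordConj n Q Z Q' Z') (h' : CliffordConj n Q' Z' Q'' Z'') :
    CliffordConj n Q Z Q'' Z'' := by
  obtain ⟨M, hM, h₁, h₂⟩ := h
  obtain ⟨N, hN, h₃, h₄⟩ := h'
  exact ⟨N * M, hN.mul hM, by rw [mul_assoc, h₁, ← mul_assoc, h₃, mul_assoc],
    by rw [mul_assoc, h₂, ← mul_assoc, h₄, mul_assoc]⟩

lemma smul {Q Z Q' Z' : Matrix (Fin (2 ^ n)) (Fin (2 ^ n)) ℂ} (c : ℂ)
    (h : CliffordConj n Q Z Q' Z') : CliffordConj n (c • Q) Z (c • Q') Z' := by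
  obtain ⟨M, hM, h₁, h₂⟩ := h
  exact ⟨M, hM, by rw [Matrix.mul_smul, h₁, Matrix.smul_mul], h₂⟩

lemma first {G A C A' C' : Matrix (Fin 2) (Fin 2) ℂ} (hG : IsClifford (n + 1) (kronFirst n G 1))
    (hA : G * A = A' * G) (hC : G * C = C' * G) (R T : Matrix (Fin (2 ^ n)) (Fin (2 ^ n)) ℂ) :
    CliffordConj (n + 1) (kronFirst n A R) (kronFirst n C T)
      (kronFirst n A' R) (kronFirst n C' T) :=
  ⟨_, hG, by simp only [kronFirst_mul, hA, one_mul, mul_one],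
    by simp only [kronFirst_mul, hC, one_mul, mul_one]⟩

lemma tail {R T R' T' : Matrix (Fin (2 ^ n)) (Fin (2 ^ n)) ℂ} (h : CliffordConj n R T R' T')
    (A C : Matrix (Fin 2) (Fin 2) ℂ) :
    CliffordConj (n + 1) (kronFirst n A R) (kronFirst n C T)
      (kronFirst n A R') (kronFirst n C T') := by
  obtain ⟨M, hM, h₁, h₂⟩ := h
  exact ⟨_, hM.kronFirst, by simp only [kronFirst_mul, h₁, one_mul, mul_one],
    by simp only [kronFirst_mul, h₂, one_mul, mul_one]⟩

lemma cz {A B C D A' B' C' D' : Matrix (Fin 2) (Fin 2) ℂ}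
    (h₁ : gCZ * kronTwo A B =
      kronTwo A' B' * gCZ)
    (h₂ : gCZ * kronTwo C D =
      kronTwo C' D' * gCZ)
    (R T : Matrix (Fin (2 ^ n)) (Fin (2 ^ n)) ℂ) :
    CliffordConj (n + 2) (kronFirst (n + 1) A (kronFirst n B R))
      (kronFirst (n + 1) C (kronFirst n D T))
      (kronFirst (n + 1) A' (kronFirst n B' R)) (kronFirst (n + 1) C' (kronFirst n D' T)) :=
  ⟨czFirst n, isClifford_czFirst n, czFirst_mul h₁ R, czFirst_mul h₂ T⟩

/-- The pair `X ⊗ I`, `Z ⊗ I` can be moved from the first qubit to the second. -/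
lemma swap (R T : Matrix (Fin (2 ^ n)) (Fin (2 ^ n)) ℂ) :
    CliffordConj (n + 2) (kronFirst (n + 1) PX (kronFirst n 1 R))
      (kronFirst (n + 1) PZ (kronFirst n 1 T))
      (kronFirst (n + 1) 1 (kronFirst n PX R)) (kronFirst (n + 1) 1 (kronFirst n PZ T)) := by
  have h1 : gH * 1 = 1 * gH := by rw [one_mul, mul_one]
  refine (cz gCZ_mul_X_one gCZ_mul_Z_one R T).trans ?_
  refine (first (isClifford_gH _) gH_mul_PX gH_mul_PZ _ _).trans ?_
  refine (tail (first (isClifford_gH _) gH_mul_PZ h1 R T) _ _).trans ?_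
  refine (cz gCZ_mul_Z_X gCZ_mul_X_one R T).trans ?_
  refine (first (isClifford_gH _) h1 gH_mul_PX _ _).trans ?_
  refine (tail (first (isClifford_gH _) gH_mul_PX gH_mul_PZ R T) _ _).trans ?_
  refine (cz gCZ_mul_one_Z gCZ_mul_Z_X R T).trans ?_
  exact tail (first (isClifford_gH _) gH_mul_PZ gH_mul_PX R T) _ _

lemma clear_second {B : Matrix (Fin 2) (Fin 2) ℂ}
    (hB : B ∈ ({1, PX, PY, PZ} : Set (Matrix (Fin 2) (Fin 2) ℂ)))
    (R T : Matrix (Fin (2 ^ n)) (Fin (2 ^ n)) ℂ) :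
    ∃ c : ℂ, (c = 1 ∨ c = -1) ∧ CliffordConj (n + 2) (kronFirst (n + 1) PX (kronFirst n B R))
      (kronFirst (n + 1) PZ (kronFirst n 1 T))
      (c • kronFirst (n + 1) PX (kronFirst n 1 R)) (kronFirst (n + 1) PZ (kronFirst n 1 T)) := by
  have hZ := cz gCZ_mul_X_Z gCZ_mul_Z_one R T
  have hX := (tail (first (isClifford_gH _) gH_mul_PX
    (by rw [one_mul, mul_one] : gH * 1 = 1 * gH) R T) PX PZ).trans hZ
  rcases hB with rfl | rfl | rfl | rfl
  · exact ⟨1, Or.inl rfl, by rw [one_smul]; exact refl _ _⟩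
  · exact ⟨1, Or.inl rfl, by rwa [one_smul]⟩
  · refine ⟨-1, Or.inr rfl, trans (tail (first (isClifford_gS _) gS_mul_PY
      (by rw [one_mul, mul_one] : gS * 1 = 1 * gS) R T) PX PZ) ?_⟩
    have e : kronFirst (n + 1) PX (kronFirst n ((-1 : ℂ) • PX) R) =
        (-1 : ℂ) • kronFirst (n + 1) PX (kronFirst n PX R) := by
      rw [kronFirst_smul_left, kronFirst, kronCast_smul_right]
      rfl
    rw [e]
    exact hX.smul _
  · exact ⟨1, Or.inl rfl, by rwa [one_smul]⟩

lemma gS_PY (R : Matrix (Fin (2 ^ n)) (Fin (2 ^ n)) ℂ) (c : ℂ) :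
    CliffordConj (n + 1) (c • kronFirst n PY R) (kronFirst n PZ 1)
      (-c • kronFirst n PX R) (kronFirst n PZ 1) := by
  have h := (first (isClifford_gS n) gS_mul_PY gS_mul_PZ R 1).smul c
  rwa [kronFirst_smul_left, smul_smul, mul_neg_one] at h

end CliffordConj

lemma tensorPow_one (n : ℕ) : tensorPow n (fun _ => 1) = 1 := by
  induction n with
  | zero => rfl
  | succ n ih => rw [tensorPow_succ, ih, kronFirst_one]

lemma ZFirst_succ (n : ℕ) : ZFirst (n + 1) = kronFirst n PZ 1 := by
  simp [ZFirst, tensorPow_succ, tensorPow_one]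

lemma XLast_one : XLast 1 = kronFirst 0 PX 1 := by
  simp [XLast, tensorPow]
  rfl

lemma ZLast_one : ZLast 1 = kronFirst 0 PZ 1 := by
  simp [ZLast, tensorPow]
  rfl

lemma XLast_succ (n : ℕ) : XLast (n + 2) = kronFirst (n + 1) 1 (XLast (n + 1)) := by
  simp [XLast, tensorPow_succ (n + 1)]

lemma ZLast_succ (n : ℕ) : ZLast (n + 2) = kronFirst (n + 1) 1 (ZLast (n + 1)) := by
  simp [ZLast, tensorPow_succ (n + 1)]

lemma cliffordConj_of_PX (n : ℕ) {c : ℂ} (hc : c = 1 ∨ c = -1)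
    (P : Fin n → Matrix (Fin 2) (Fin 2) ℂ)
    (hP : ∀ i, P i ∈ ({1, PX, PY, PZ} : Set (Matrix (Fin 2) (Fin 2) ℂ))) :
    CliffordConj (n + 1) (c • kronFirst n PX (tensorPow n P)) (kronFirst n PZ 1)
      (XLast (n + 1)) (ZLast (n + 1)) := by
  induction n generalizing c with
  | zero =>
    rw [XLast_one, ZLast_one]
    change CliffordConj 1 (c • kronFirst 0 PX 1) _ _ _
    rcases hc with rfl | rfl
    · rw [one_smul]
      exact CliffordConj.refl _ _
    · have h := ((CliffordConj.first (isClifford_gS 0) gS_mul_PX gS_mul_PZ 1 1).smul (-1)).trans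
        (CliffordConj.gS_PY 1 (-1))
      rwa [neg_neg, one_smul] at h
  | succ n ih =>
    obtain ⟨d, hd, h⟩ := CliffordConj.clear_second (hP 0) (tensorPow n fun i => P i.succ) 1
    have hcd : c * d = 1 ∨ c * d = -1 := by
      rcases hc with rfl | rfl <;> rcases hd with rfl | rfl <;> simp
    have h' := (ih hcd (fun i => P i.succ) fun i => hP i.succ).tail 1 1
    have hs := (CliffordConj.swap (tensorPow n fun i => P i.succ) 1).smul (c * d)
    have h := h.smul c
    rw [smul_smul, kronFirst_one] at h
    rw [kronFirst_one] at hs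
    rw [kronFirst, kronCast_smul_right] at h'
    rw [XLast_succ, ZLast_succ, tensorPow_succ]
    exact h.trans (hs.trans h')

lemma PX_mul_PX : PX * PX = 1 := by
  ext i j
  fin_cases i <;> fin_cases j <;> simp [PX]

lemma PY_mul_PY : PY * PY = 1 := by
  ext i j
  fin_cases i <;> fin_cases j <;> simp [PY]

lemma PZ_mul_PZ : PZ * PZ = 1 := by
  ext i j
  fin_cases i <;> fin_cases j <;> simp [PZ]

lemma tensorPow_mul_self (n : ℕ) (P : Fin n → Matrix (Fin 2) (Fin 2) ℂ)
    (hP : ∀ i, P i ∈ ({1, PX, PY, PZ} : Set (Matrix (Fin 2) (Fin 2) ℂ))) :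
    tensorPow n P * tensorPow n P = 1 := by
  induction n with
  | zero => exact one_mul _
  | succ n ih =>
    have h0 : P 0 * P 0 = 1 := by
      rcases hP 0 with h | h | h | h <;> rw [h]
      exacts [one_mul _, PX_mul_PX, PY_mul_PY, PZ_mul_PZ]
    rw [tensorPow_succ, kronFirst_mul, ih _ fun i => hP i.succ, h0, kronFirst_one]

lemma eq_one_or_neg_one_of_smul_mul_self {n : ℕ} {c : ℂ}
    {T : Matrix (Fin (2 ^ n)) (Fin (2 ^ n)) ℂ} (hT : T * T = 1) (h : (c • T) * (c • T) = 1) :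
    c = 1 ∨ c = -1 := by
  rw [Matrix.smul_mul, Matrix.mul_smul, smul_smul, hT] at h
  have h0 := congrFun (congrFun h 0) 0
  rw [Matrix.smul_apply, Matrix.one_apply_eq, smul_eq_mul, mul_one] at h0
  exact mul_self_eq_one_iff.mp h0

lemma not_commute_of_anticommute {n : ℕ} {Q Z : Matrix (Fin (2 ^ n)) (Fin (2 ^ n)) ℂ}
    (hQ : Q * Q = 1) (hZ : Z * Z = 1) (h : Q * Z = -(Z * Q)) : Q * Z ≠ Z * Q := by
  intro h'
  have h0 : Q * Z = 0 := by
    rw [← h'] at h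
    ext i j
    exact self_eq_neg.mp (congrFun (congrFun h i) j)
  have h1 : (1 : Matrix (Fin (2 ^ n)) (Fin (2 ^ n)) ℂ) = 0 := by
    calc 1 = Q * (Q * Z) * Z := by rw [← mul_assoc, hQ, one_mul, hZ]
      _ = 0 := by rw [h0, mul_zero, zero_mul]
  exact one_ne_zero h1

/-- For n ≥ 1, if Q is a self-inverse Pauli operator anticommuting with
Z ⊗ I ⊗ ⋯ ⊗ I, then some Clifford conjugation sends Q to I ⊗ ⋯ ⊗ I ⊗ X and
Z ⊗ I ⊗ ⋯ ⊗ I to I ⊗ ⋯ ⊗ I ⊗ Z. -/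
theorem pauli_to_XLast (n : ℕ) (hn : 1 ≤ n)
    (Q : Matrix (Fin (2 ^ n)) (Fin (2 ^ n)) ℂ) (hQ : Q ∈ PauliSet n)
    (hQ2 : Q * Q = 1)
    (hanti : Q * ZFirst n = -(ZFirst n * Q)) :
    ∃ M ∈ CliffordGroup n,
      (M : Matrix (Fin (2 ^ n)) (Fin (2 ^ n)) ℂ) * Q *
        ((M⁻¹ : GL (Fin (2 ^ n)) ℂ) : Matrix (Fin (2 ^ n)) (Fin (2 ^ n)) ℂ)
        = XLast n ∧
      (M : Matrix (Fin (2 ^ n)) (Fin (2 ^ n)) ℂ) * ZFirst n *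
        ((M⁻¹ : GL (Fin (2 ^ n)) ℂ) : Matrix (Fin (2 ^ n)) (Fin (2 ^ n)) ℂ)
        = ZLast n := by
  obtain ⟨n, rfl⟩ := Nat.exists_eq_add_of_le' hn
  obtain ⟨c, P, -, hP, rfl⟩ := hQ
  have hc := eq_one_or_neg_one_of_smul_mul_self (tensorPow_mul_self _ P hP) hQ2
  have hZ : ZFirst (n + 1) * ZFirst (n + 1) = 1 := by
    rw [ZFirst_succ, kronFirst_mul, PZ_mul_PZ, one_mul, kronFirst_one]
  have hcomm := not_commute_of_anticommute hQ2 hZ hanti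
  have hX (d : ℂ) (hd : d = 1 ∨ d = -1) := cliffordConj_of_PX n hd _ fun i => hP i.succ
  suffices h : CliffordConj (n + 1) (c • tensorPow (n + 1) P) (ZFirst (n + 1))
      (XLast (n + 1)) (ZLast (n + 1)) by
    obtain ⟨_, ⟨u, hu, rfl⟩, h₁, h₂⟩ := h
    refine ⟨u, hu, ?_, ?_⟩
    · rw [h₁, mul_assoc, ← Units.val_mul, mul_inv_cancel, Units.val_one, mul_one]
    · rw [h₂, mul_assoc, ← Units.val_mul, mul_inv_cancel, Units.val_one, mul_one]
  rw [ZFirst_succ, tensorPow_succ] at hcomm ⊢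
  rcases hP 0 with h | h | h | h <;> rw [h] at hcomm ⊢
  · simp [kronFirst_mul] at hcomm
  · exact hX c hc
  · exact (CliffordConj.gS_PY _ c).trans (hX (-c) (by rcases hc with rfl | rfl <;> simp))
  · simp [kronFirst_mul] at hcomm
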